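/- ∑_{k=0}^∞ (1/2)_k (1/4)_k (3/4)_k / (k!)^3 · (8k+1)/9^k = 2√3/π. -/

import Mathlib

/-- The Pochhammer symbol `(x)ₖ = x (x+1) ⋯ (x+k-1)`, with `(x)₀ = 1`. -/
noncomputable def poch (x : ℝ) (k : ℕ) : ℝ :=
  ∏ i ∈ Finset.range k, (x + i)

open Filter Topology

lemma poch_zero (x : ℝ) : poch x 0 = 1 := by
  simp [poch]

lemma poch_succ (x : ℝ) (k : ℕ) : poch x (k + 1) = poch x k * (x + k) := by
  simp [poch, Finset.prod_range_succ]

lemma poch_pos {x : ℝ} (hx : 0 < x) (k : ℕ) : 0 < poch x k :=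
  Finset.prod_pos fun i _ => by positivity

lemma poch_two_mul (x : ℝ) (k : ℕ) :
    poch x (2 * k) = 4 ^ k * poch (x / 2) k * poch ((x + 1) / 2) k := by
  induction k with
  | zero => simp [poch_zero]
  | succ k ih =>
    rw [show 2 * (k + 1) = 2 * k + 1 + 1 by ring, poch_succ, poch_succ, ih, poch_succ, poch_succ]
    push_cast
    ring

lemma poch_eq_factorial_mul_choose (x : ℝ) (k : ℕ) :
    poch x k = k.factorial * Ring.choose (x + k - 1) k := by
  have h := Ring.factorial_nsmul_multichoose_eq_ascPochhammer x k
  rw [Polynomial.ascPochhammer_smeval_eq_eval, nsmul_eq_mul, Ring.multichoose_eq] at h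
  rw [h]
  clear h
  induction k with
  | zero => simp [poch_zero]
  | succ k ih => rw [poch_succ, ascPochhammer_succ_eval, ih]

/-- The binomial series for `(1 - t) ^ (-x)`. -/
lemma tsum_poch_div_factorial_mul_pow (x : ℝ) {t : ℝ} (ht : |t| < 1) :
    ∑' k : ℕ, poch x k / k.factorial * t ^ k = 1 / (1 - t) ^ x := by
  have h := (Real.one_div_one_sub_rpow_hasFPowerSeriesOnBall_zero x).hasSum (y := t) (by
    simpa [enorm_eq_nnnorm] using! ht)
  simp only [zero_add, FormalMultilinearSeries.ofScalars_apply_eq, smul_eq_mul] at h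
  rw [← h.tsum_eq]
  refine tsum_congr fun k => ?_
  rw [poch_eq_factorial_mul_choose, mul_div_cancel_left₀ _ (by positivity)]

/-- The hypergeometric part of the summand, with a shift parameter `x`. -/
noncomputable def hyperTerm (x : ℝ) (k : ℕ) : ℝ :=
  poch (1 / 2) k * poch (3 * x + 1 / 2) (2 * k) / (k.factorial * 36 ^ k * poch (x + 1) k ^ 2)

/-- The summand of Ramanujan's series, with a shift parameter `x`. -/
noncomputable def shiftedTerm (x : ℝ) (k : ℕ) : ℝ :=
  (6 * x + 8 * k + 1) / (6 * x + 1) * hyperTerm x k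

lemma hyperTerm_zero (x : ℝ) : hyperTerm x 0 = 1 := by
  simp [hyperTerm, poch_zero]

lemma hyperTerm_succ {x : ℝ} (hx : 0 ≤ x) (k : ℕ) :
    hyperTerm x (k + 1) = hyperTerm x k *
      ((2 * k + 1) * (6 * x + 4 * k + 1) * (6 * x + 4 * k + 3) /
        (288 * (k + 1) * (x + 1 + k) ^ 2)) := by
  have h := poch_pos (show 0 < x + 1 by linarith) k
  have h' : 0 < x + 1 + k := by positivity
  rw [hyperTerm, hyperTerm, show 2 * (k + 1) = 2 * k + 1 + 1 by ring, poch_succ, poch_succ,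
    poch_succ, poch_succ, Nat.factorial_succ]
  push_cast
  field_simp
  ring

lemma hyperTerm_nonneg {x : ℝ} (hx : 0 ≤ x) (k : ℕ) : 0 ≤ hyperTerm x k := by
  have h₁ := poch_pos (show (0 : ℝ) < 1 / 2 by norm_num) k
  have h₂ := poch_pos (show 0 < 3 * x + 1 / 2 by linarith) (2 * k)
  unfold hyperTerm
  positivity

lemma hyperTerm_le {x : ℝ} (hx : 0 ≤ x) (k : ℕ) : hyperTerm x k ≤ (1 / 4) ^ k := by
  induction k with
  | zero => simp [hyperTerm_zero]
  | succ k ih =>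
    rw [hyperTerm_succ hx, pow_succ]
    refine mul_le_mul ih ?_ (by positivity) (pow_nonneg (by norm_num) k)
    have hk : (0 : ℝ) ≤ k := k.cast_nonneg
    rw [div_le_div_iff₀ (by positivity) (by norm_num)]
    have h₁ : (6 * x + 4 * k + 1) * (6 * x + 4 * k + 3) ≤ 36 * (x + 1 + k) ^ 2 := by
      nlinarith [mul_nonneg hx hk]
    have h₂ : (2 * (k : ℝ) + 1) * ((6 * x + 4 * k + 1) * (6 * x + 4 * k + 3)) ≤
        (2 * (k + 1)) * (36 * (x + 1 + k) ^ 2) :=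
      mul_le_mul (by linarith) h₁ (by positivity) (by positivity)
    linarith

lemma hyperTerm_add_one {x : ℝ} (hx : 0 ≤ x) (k : ℕ) :
    hyperTerm (x + 1) k = hyperTerm x k *
      ((6 * x + 4 * k + 1) * (6 * x + 4 * k + 3) * (6 * x + 4 * k + 5) * (x + 1) ^ 2 /
        ((6 * x + 1) * (6 * x + 3) * (6 * x + 5) * (x + 1 + k) ^ 2)) := by
  induction k with
  | zero =>
    simp only [hyperTerm_zero, Nat.cast_zero, mul_zero, add_zero, one_mul]
    rw [div_self (by positivity)]
  | succ k ih =>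
    rw [hyperTerm_succ (by linarith), hyperTerm_succ hx, ih]
    push_cast
    field_simp
    ring

/-- The companion of `shiftedTerm` in its Wilf–Zeilberger pair. -/
noncomputable def wzCompanion (x : ℝ) (k : ℕ) : ℝ :=
  8 * (x + 1) ^ 2 * k * (1 - 2 * k) / ((6 * x + 1) * (6 * x + 3)) * hyperTerm x k

lemma shiftedTerm_add_one_sub {x : ℝ} (hx : 0 ≤ x) (k : ℕ) :
    (x + 5 / 6) * (x + 7 / 6) * shiftedTerm (x + 1) k - (x + 1) ^ 2 * shiftedTerm x k =
      wzCompanion x (k + 1) - wzCompanion x k := by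
  rw [shiftedTerm, shiftedTerm, wzCompanion, wzCompanion, hyperTerm_add_one hx, hyperTerm_succ hx]
  have : 0 < 6 * (x + 1) + 1 := by linarith
  push_cast
  field_simp
  ring

lemma tendsto_wzCompanion {x : ℝ} (hx : 0 ≤ x) : Tendsto (wzCompanion x) atTop (𝓝 0) := by
  have h₁ := tendsto_pow_const_mul_const_pow_of_lt_one 1
    (show (0 : ℝ) ≤ 1 / 4 by norm_num) (by norm_num)
  have h₂ := tendsto_pow_const_mul_const_pow_of_lt_one 2
    (show (0 : ℝ) ≤ 1 / 4 by norm_num) (by norm_num)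
  have h := ((h₁.add (h₂.const_mul 2)).const_mul (8 * (x + 1) ^ 2 / ((6 * x + 1) * (6 * x + 3))))
  simp only [mul_zero, add_zero] at h
  refine squeeze_zero_norm (fun k => ?_) h
  have hq := hyperTerm_le hx k
  have hq' := hyperTerm_nonneg hx k
  have hk : |1 - 2 * (k : ℝ)| ≤ 1 + 2 * k := abs_le.2 ⟨by linarith, by
    linarith [k.cast_nonneg (α := ℝ)]⟩
  calc ‖wzCompanion x k‖
      = 8 * (x + 1) ^ 2 / ((6 * x + 1) * (6 * x + 3)) *
          (k * |1 - 2 * (k : ℝ)| * hyperTerm x k) := by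
        rw [show wzCompanion x k = 8 * (x + 1) ^ 2 / ((6 * x + 1) * (6 * x + 3)) *
          (k * (1 - 2 * (k : ℝ)) * hyperTerm x k) by rw [wzCompanion]; ring, Real.norm_eq_abs,
          abs_mul, abs_mul, abs_mul, abs_of_nonneg hq', Nat.abs_cast, abs_of_nonneg (by positivity)]
    _ ≤ 8 * (x + 1) ^ 2 / ((6 * x + 1) * (6 * x + 3)) *
          (k * (1 + 2 * (k : ℝ)) * (1 / 4) ^ k) := by gcongr
    _ = _ := by ring

lemma norm_shiftedTerm_le {x : ℝ} (hx : 0 ≤ x) (k : ℕ) :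
    ‖shiftedTerm x k‖ ≤ (1 + 8 * k) * (1 / 4) ^ k := by
  have hq := hyperTerm_nonneg hx k
  rw [Real.norm_of_nonneg (by unfold shiftedTerm; positivity), shiftedTerm]
  refine mul_le_mul ?_ (hyperTerm_le hx k) hq (by positivity)
  rw [div_le_iff₀ (by positivity)]
  nlinarith [mul_nonneg hx (k.cast_nonneg (α := ℝ))]

lemma summable_one_add_mul_geometric : Summable fun k : ℕ => (1 + 8 * (k : ℝ)) * (1 / 4) ^ k := by
  have h₁ := summable_geometric_of_lt_one (show (0 : ℝ) ≤ 1 / 4 by norm_num) (by norm_num)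
  have h₂ := summable_pow_mul_geometric_of_norm_lt_one 1 (show ‖(1 / 4 : ℝ)‖ < 1 by norm_num)
  exact (h₁.add (h₂.mul_left 8)).congr fun k => by ring

lemma summable_shiftedTerm {x : ℝ} (hx : 0 ≤ x) : Summable (shiftedTerm x) :=
  summable_one_add_mul_geometric.of_norm_bounded (norm_shiftedTerm_le hx)

lemma tsum_shiftedTerm_add_one {x : ℝ} (hx : 0 ≤ x) :
    (x + 5 / 6) * (x + 7 / 6) * ∑' k, shiftedTerm (x + 1) k =
      (x + 1) ^ 2 * ∑' k, shiftedTerm x k := by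
  have h₁ := (summable_shiftedTerm (show 0 ≤ x + 1 by linarith)).hasSum.mul_left
    ((x + 5 / 6) * (x + 7 / 6))
  have h₂ := (summable_shiftedTerm hx).hasSum.mul_left ((x + 1) ^ 2)
  have h := (h₁.sub h₂).tendsto_sum_nat
  simp only [shiftedTerm_add_one_sub hx, Finset.sum_range_sub] at h
  have h₀ : wzCompanion x 0 = 0 := by simp [wzCompanion]
  have h' := (tendsto_wzCompanion hx).sub_const (wzCompanion x 0)
  rw [h₀, sub_zero] at h'
  rw [h₀] at h
  exact sub_eq_zero.1 (tendsto_nhds_unique h h')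

lemma tsum_shiftedTerm_zero_eq (n : ℕ) :
    ∑' k, shiftedTerm 0 k =
      (∏ j ∈ Finset.range n, (1 - (1 / 6 : ℝ) ^ 2 / (j + 1) ^ 2)) * ∑' k, shiftedTerm n k := by
  induction n with
  | zero => simp
  | succ n ih =>
    have h := tsum_shiftedTerm_add_one (n.cast_nonneg (α := ℝ))
    rw [ih, Finset.prod_range_succ, mul_assoc]
    congr 1
    push_cast
    field_simp
    linear_combination -36 * h

lemma tendsto_add_const_div_add_const {a b c d : ℝ} (hc : c ≠ 0) :
    Tendsto (fun x : ℝ => (a * x + b) / (c * x + d)) atTop (𝓝 (a / c)) := by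
  have h : Tendsto (fun x : ℝ => (a + b * x⁻¹) / (c + d * x⁻¹)) atTop
      (𝓝 ((a + b * 0) / (c + d * 0))) :=
    ((tendsto_inv_atTop_zero.const_mul b).const_add a).div
      ((tendsto_inv_atTop_zero.const_mul d).const_add c) (by simpa using hc)
  simp only [mul_zero, add_zero] at h
  refine h.congr' ?_
  filter_upwards [eventually_gt_atTop 0] with x hx
  rw [← mul_div_mul_right _ _ hx.ne']
  congr 1 <;> field_simp

lemma tendsto_hyperTerm (k : ℕ) :
    Tendsto (fun x => hyperTerm x k) atTop (𝓝 (poch (1 / 2) k / k.factorial * (1 / 4) ^ k)) := by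
  induction k with
  | zero => simp [hyperTerm_zero, poch_zero]
  | succ k ih =>
    have h₁ := tendsto_add_const_div_add_const (a := 6) (b := 4 * k + 1) (d := 1 + k)
      (one_ne_zero (α := ℝ))
    have h₂ := tendsto_add_const_div_add_const (a := 6) (b := 4 * k + 3) (d := 1 + k)
      (one_ne_zero (α := ℝ))
    have h := ih.mul ((h₁.mul h₂).const_mul ((2 * k + 1) / (288 * (k + 1)) : ℝ))
    convert! h.congr' ?_ using 2
    · rw [poch_succ, Nat.factorial_succ]
      push_cast
      field_simp
      ring
    · filter_upwards [eventually_ge_atTop 0] with x hx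
      rw [hyperTerm_succ hx]
      field_simp
      ring

lemma tendsto_shiftedTerm (k : ℕ) :
    Tendsto (fun x => shiftedTerm x k) atTop (𝓝 (poch (1 / 2) k / k.factorial * (1 / 4) ^ k)) := by
  have h := (tendsto_add_const_div_add_const (a := 6) (b := 8 * k + 1) (d := 1)
    (show (6 : ℝ) ≠ 0 by norm_num)).mul (tendsto_hyperTerm k)
  rw [div_self (by norm_num), one_mul] at h
  simpa only [shiftedTerm, add_assoc] using h

lemma tendsto_tsum_shiftedTerm :
    Tendsto (fun n : ℕ => ∑' k, shiftedTerm n k) atTop (𝓝 (2 / √3)) := by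
  have h := tendsto_tsum_of_dominated_convergence summable_one_add_mul_geometric
    (fun k => (tendsto_shiftedTerm k).comp tendsto_natCast_atTop_atTop)
    (Eventually.of_forall fun n k => norm_shiftedTerm_le n.cast_nonneg k)
  rw [tsum_poch_div_factorial_mul_pow _ (by norm_num [abs_of_pos])] at h
  convert! h using 2
  rw [← Real.sqrt_eq_rpow, show (1 - 1 / 4 : ℝ) = 3 / 2 ^ 2 by norm_num,
    Real.sqrt_div (by norm_num), Real.sqrt_sq (by norm_num), one_div_div]

lemma tendsto_prod_one_sub_one_div_six_sq :
    Tendsto (fun n : ℕ => ∏ j ∈ Finset.range n, (1 - (1 / 6 : ℝ) ^ 2 / (j + 1) ^ 2)) atTop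
      (𝓝 (3 / Real.pi)) := by
  have h := (Real.tendsto_euler_sin_prod (1 / 6)).const_mul (6 / Real.pi)
  rw [mul_one_div, Real.sin_pi_div_six] at h
  convert! h using 2
  · field_simp
  · ring

lemma shiftedTerm_zero (k : ℕ) :
    shiftedTerm 0 k = (poch (1/2) k * poch (1/4) k * poch (3/4) k) / ((k.factorial : ℝ) ^ 3) *
      ((8*(k : ℝ) + 1) / (9 : ℝ) ^ k) := by
  have h : poch 1 k = k.factorial := by
    rw [poch_eq_factorial_mul_choose, add_sub_cancel_left, Ring.choose_natCast, Nat.choose_self,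
      Nat.cast_one, mul_one]
  rw [shiftedTerm, hyperTerm, poch_two_mul, mul_zero, zero_add, zero_add, h,
    show (36 : ℝ) ^ k = 4 ^ k * 9 ^ k by rw [← mul_pow]; norm_num,
    show ((3 * 0 + 1 / 2) / 2 : ℝ) = 1 / 4 by norm_num,
    show ((3 * 0 + 1 / 2 + 1) / 2 : ℝ) = 3 / 4 by norm_num]
  field_simp

theorem ramanujan_second :
    ∑' k : ℕ, (poch (1/2) k * poch (1/4) k * poch (3/4) k) / ((k.factorial : ℝ) ^ 3) * ((8*(k : ℝ) + 1) / (9 : ℝ) ^ k) = 2 * Real.sqrt 3 / Real.pi := by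
  simp only [← shiftedTerm_zero]
  have h := tendsto_prod_one_sub_one_div_six_sq.mul tendsto_tsum_shiftedTerm
  simp only [← tsum_shiftedTerm_zero_eq] at h
  rw [tendsto_nhds_unique tendsto_const_nhds h]
  have h3 : √(3 : ℝ) ^ 2 = 3 := Real.sq_sqrt (by norm_num)
  field_simp
  linear_combination -h3
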